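/- Let G be a finite group and S ⊆ G a symmetric generating set (S = S⁻¹, 1 ∉ S, ⟨S⟩ = G). Let P be the G×G real matrix with P(x,y) = 1/|S| if x⁻¹y ∈ S and P(x,y) = 0 otherwise, and let H̃ be the subgroup of G generated by all products ab with a, b ∈ S. Then for every n ≥ 1, ∑_{h ∈ H̃} | P^{2n}(1,h) − 1/|H̃| | ≤ √|H̃| · (1 − 1/(|S|² · |H̃|²))ⁿ. (Equivalently, the total variation distance between the distribution of the simple random walk on the Cayley graph of (G,S) started at the identity after 2n steps and the uniform distribution on H̃ is at most ½ √|H̃| (1 − 1/(|S|²|H̃|²))ⁿ.) -/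

import Mathlib

open scoped Classical

namespace RandomWalk

/-- A function on a finite group that grows by at most `c` along each generator is bounded by
its value at `1` plus `c` times the order of the group. -/
lemma le_card_mul_of_closure_eq_top {K : Type*} [Group K] [Fintype K] {T : Set K}
    (hT : ∀ g ∈ T, g⁻¹ ∈ T) (hclosure : Subgroup.closure T = ⊤) {ρ : K → ℝ} {c : ℝ} (hc : 0 ≤ c)
    (hρ : ∀ h, ∀ g ∈ T, ρ (h * g) ≤ ρ h + c) (h : K) :
    ρ h ≤ ρ 1 + Fintype.card K * c := by
  let Γ : SimpleGraph K :=
    { Adj := fun x y => x ≠ y ∧ x⁻¹ * y ∈ T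
      symm := ⟨fun x y hxy => ⟨hxy.1.symm, by simpa using hT _ hxy.2⟩⟩
      loopless := ⟨fun x hx => hx.1 rfl⟩ }
  have hstep (x g : K) (hg : g ∈ T) : Γ.Reachable x (x * g) := by
    by_cases hx : x = x * g
    · rw [← hx]
    · exact SimpleGraph.Adj.reachable (show Γ.Adj x (x * g) from ⟨hx, by simpa using hg⟩)
  have hreach : Γ.Reachable 1 h := by
    have hmem : h ∈ Subgroup.closure T := hclosure ▸ Subgroup.mem_top h
    induction hmem using Subgroup.closure_induction_right with
    | one => exact SimpleGraph.Reachable.refl _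
    | mul_right x _ y hy ih => exact ih.trans (hstep x y hy)
    | mul_inv_cancel x _ y hy ih => exact ih.trans (hstep x _ (hT y hy))
  have hwalk : ∀ {x y : K} (w : Γ.Walk x y), ρ y ≤ ρ x + w.length * c := by
    intro x y w
    induction w with
    | nil => simp
    | @cons u v _ huv _ ih =>
      have hv := hρ u _ huv.2
      rw [mul_inv_cancel_left] at hv
      rw [SimpleGraph.Walk.length_cons]
      push_cast
      linarith
  obtain ⟨p, hp⟩ := hreach.exists_isPath
  have hlen : (p.length : ℝ) ≤ Fintype.card K := by exact_mod_cast hp.length_lt.le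
  have := mul_le_mul_of_nonneg_right hlen hc
  linarith [hwalk p]

variable {G : Type*} [Group G]

/-- The transition matrix of the simple random walk on the Cayley graph of `(G, S)`. -/
noncomputable def transition (S : Finset G) : Matrix G G ℝ :=
  fun x y => if x⁻¹ * y ∈ S then (1 : ℝ) / S.card else 0

/-- The subgroup generated by the products of two elements of `S`. -/
def evenSubgroup (S : Finset G) : Subgroup G :=
  Subgroup.closure {g : G | ∃ a ∈ S, ∃ b ∈ S, g = a * b}

variable {S : Finset G}

lemma mul_mem_evenSubgroup {a b : G} (ha : a ∈ S) (hb : b ∈ S) : a * b ∈ evenSubgroup S :=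
  Subgroup.subset_closure ⟨a, ha, b, hb, rfl⟩

lemma closure_preimage_evenSubgroup :
    Subgroup.closure ((↑) ⁻¹' {g : G | ∃ a ∈ S, ∃ b ∈ S, g = a * b} : Set (evenSubgroup S)) = ⊤ :=
  Subgroup.closure_closure_coe_preimage

lemma transition_isSymm (hsym : ∀ a : G, a ∈ S ↔ a⁻¹ ∈ S) : (transition S).IsSymm := by
  ext x y
  simp only [Matrix.transpose_apply, transition]
  exact if_congr (by simpa using hsym (y⁻¹ * x)) rfl rfl

variable [Fintype G]

/-- The squared `ℓ²` distance between `f` and its right translate by `g`. -/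
noncomputable def energy (f : G → ℝ) (g : G) : ℝ := ∑ x, (f x - f (x * g)) ^ 2

lemma energy_nonneg (f : G → ℝ) (g : G) : 0 ≤ energy f g :=
  Finset.sum_nonneg fun _ _ => sq_nonneg _

lemma sum_mul_right (f : G → ℝ) (g : G) : ∑ x, f (x * g) = ∑ x, f x :=
  Equiv.sum_comp (Equiv.mulRight g) f

lemma sqrt_energy_mul_le (f : G → ℝ) (g h : G) :
    √(energy f (g * h)) ≤ √(energy f g) + √(energy f h) := by
  have key := norm_add_le (WithLp.toLp 2 fun x => f x - f (x * g) : EuclideanSpace ℝ G)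
    (WithLp.toLp 2 fun x => f (x * g) - f (x * g * h))
  have htranslate : ∑ x, (f (x * g) - f (x * g * h)) ^ 2 = energy f h :=
    sum_mul_right (fun x => (f x - f (x * h)) ^ 2) g
  simp only [EuclideanSpace.norm_eq, PiLp.add_apply, sub_add_sub_cancel, Real.norm_eq_abs,
    sq_abs, mul_assoc] at key htranslate
  rw [htranslate] at key
  simpa only [energy] using key

lemma sum_mul_translate (f : G → ℝ) (s t : G) :
    ∑ x, f (x * s) * f (x * t) = ∑ x, f x ^ 2 - energy f (s⁻¹ * t) / 2 := by
  have hs : ∑ x, f (x * s) ^ 2 = ∑ x, f x ^ 2 := sum_mul_right (fun x => f x ^ 2) s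
  have ht : ∑ x, f (x * t) ^ 2 = ∑ x, f x ^ 2 := sum_mul_right (fun x => f x ^ 2) t
  have he : energy f (s⁻¹ * t) = ∑ x, (f (x * s) - f (x * t)) ^ 2 := by
    rw [energy, ← sum_mul_right _ s]
    simp [mul_assoc]
  have hsplit : ∑ x, (f (x * s) - f (x * t)) ^ 2
      = ∑ x, f (x * s) ^ 2 + ∑ x, f (x * t) ^ 2 - 2 * ∑ x, f (x * s) * f (x * t) := by
    rw [Finset.mul_sum, ← Finset.sum_add_distrib, ← Finset.sum_sub_distrib]
    exact Finset.sum_congr rfl fun x _ => by ring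
  rw [he, hsplit, hs, ht]
  ring

/-- The subspace of functions supported on `K` with sum zero. -/
def IsCentered (K : Subgroup G) (f : G → ℝ) : Prop := (∀ x ∉ K, f x = 0) ∧ ∑ x, f x = 0

lemma sum_subgroup {K : Subgroup G} {f : G → ℝ} (hf : ∀ x ∉ K, f x = 0) :
    ∑ h : K, f h = ∑ x, f x := by
  rw [← Finset.sum_subset (Finset.subset_univ {x | x ∈ K}) fun x _ hx => hf x (by simpa using hx)]
  exact (Finset.sum_subtype _ (by simp) f).symm

lemma sum_energy_subgroup {K : Subgroup G} {f : G → ℝ} (hf : IsCentered K f) :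
    ∑ h : K, energy f h = 2 * Nat.card K * ∑ x, f x ^ 2 := by
  have hcross : ∑ h : K, ∑ x, f x * f (x * h) = 0 := by
    rw [Finset.sum_comm]
    refine Finset.sum_eq_zero fun x _ => ?_
    rw [← Finset.mul_sum]
    by_cases hx : x ∈ K
    · have := Equiv.sum_comp (Equiv.mulLeft (⟨x, hx⟩ : K)) (fun h : K => f h)
      simp only [Equiv.coe_mulLeft, Subgroup.coe_mul, sum_subgroup hf.1, hf.2] at this
      rw [this, mul_zero]
    · rw [hf.1 x hx, zero_mul]
  have hexpand (h : K) :
      energy f h = 2 * ∑ x, f x ^ 2 - 2 * ∑ x, f x * f (x * h) := by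
    have := sum_mul_translate f 1 h
    simp only [mul_one, inv_one, one_mul] at this
    rw [this]
    ring
  simp only [hexpand, Finset.sum_sub_distrib, ← Finset.mul_sum, hcross]
  simp [Nat.card_eq_fintype_card]
  ring

lemma transition_mulVec (f : G → ℝ) (x : G) :
    (transition S).mulVec f x = (∑ s ∈ S, f (x * s)) / S.card := by
  rw [Matrix.mulVec, dotProduct, ← Equiv.sum_comp (Equiv.mulLeft x)]
  simp [transition, ite_mul, div_eq_inv_mul, Finset.mul_sum]

lemma transition_sq_mulVec (f : G → ℝ) (x : G) :
    (transition S ^ 2).mulVec f x = (∑ s ∈ S, ∑ t ∈ S, f (x * (s * t))) / S.card ^ 2 := by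
  rw [pow_two, ← Matrix.mulVec_mulVec, transition_mulVec]
  simp only [transition_mulVec, ← Finset.sum_div, mul_assoc, div_div, pow_two]

lemma sum_transition_mulVec (f : G → ℝ) (hS : S.Nonempty) :
    ∑ x, (transition S).mulVec f x = ∑ x, f x := by
  have hd : (S.card : ℝ) ≠ 0 := by exact_mod_cast hS.card_pos.ne'
  simp only [transition_mulVec, ← Finset.sum_div]
  rw [Finset.sum_comm]
  simp only [sum_mul_right, Finset.sum_const, nsmul_eq_mul]
  field_simp

lemma IsCentered.transition_sq_mulVec (hS : S.Nonempty) {f : G → ℝ}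
    (hf : IsCentered (evenSubgroup S) f) :
    IsCentered (evenSubgroup S) ((transition S ^ 2).mulVec f) := by
  constructor
  · intro x hx
    rw [RandomWalk.transition_sq_mulVec, Finset.sum_eq_zero, zero_div]
    refine fun s hs => Finset.sum_eq_zero fun t ht => hf.1 _ fun hmem => hx ?_
    exact (Subgroup.mul_mem_cancel_right _ (mul_mem_evenSubgroup hs ht)).1 hmem
  · rw [pow_two, ← Matrix.mulVec_mulVec, sum_transition_mulVec _ hS, sum_transition_mulVec _ hS,
      hf.2]

lemma sum_sq_transition_mulVec (hS : S.Nonempty) (f : G → ℝ) :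
    ∑ x, (transition S).mulVec f x ^ 2
      = ∑ x, f x ^ 2 - (∑ s ∈ S, ∑ t ∈ S, energy f (s⁻¹ * t)) / (2 * S.card ^ 2) := by
  have hd : (S.card : ℝ) ≠ 0 := by exact_mod_cast hS.card_pos.ne'
  have hswap : ∑ x, (∑ s ∈ S, f (x * s)) ^ 2
      = ∑ s ∈ S, ∑ t ∈ S, ∑ x, f (x * s) * f (x * t) := by
    simp only [pow_two, Finset.sum_mul_sum]
    rw [Finset.sum_comm]
    exact Finset.sum_congr rfl fun s _ => Finset.sum_comm
  simp only [transition_mulVec, div_pow, ← Finset.sum_div]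
  rw [hswap]
  simp only [sum_mul_translate, Finset.sum_sub_distrib, ← Finset.sum_div, Finset.sum_const,
    nsmul_eq_mul]
  field_simp

/-- A Poincaré inequality for functions on `evenSubgroup S`. -/
lemma two_mul_sum_sq_le (hsym : ∀ a : G, a ∈ S ↔ a⁻¹ ∈ S) {f : G → ℝ}
    (hf : IsCentered (evenSubgroup S) f) :
    2 * ∑ x, f x ^ 2
      ≤ (Nat.card (evenSubgroup S) : ℝ) ^ 2 * ∑ s ∈ S, ∑ t ∈ S, energy f (s⁻¹ * t) := by
  set M := ∑ s ∈ S, ∑ t ∈ S, energy f (s⁻¹ * t) with hM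
  have hM0 : 0 ≤ M := Finset.sum_nonneg fun s _ => Finset.sum_nonneg fun t _ => energy_nonneg _ _
  have hle {a b : G} (ha : a ∈ S) (hb : b ∈ S) : energy f (a * b) ≤ M := by
    have hinner := Finset.single_le_sum (f := fun t => energy f (a⁻¹⁻¹ * t))
      (fun t _ => energy_nonneg _ _) hb
    have houter := Finset.single_le_sum (f := fun s => ∑ t ∈ S, energy f (s⁻¹ * t))
      (fun s _ => Finset.sum_nonneg fun t _ => energy_nonneg _ _) ((hsym a).1 ha)
    simp only [inv_inv] at hinner houter
    exact hinner.trans houter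
  have hbound (h : evenSubgroup S) :
      energy f h ≤ (Nat.card (evenSubgroup S) : ℝ) ^ 2 * M := by
    have hinv : ∀ g ∈ ((↑) ⁻¹' {g : G | ∃ a ∈ S, ∃ b ∈ S, g = a * b} : Set (evenSubgroup S)),
        g⁻¹ ∈ ((↑) ⁻¹' {g : G | ∃ a ∈ S, ∃ b ∈ S, g = a * b} : Set (evenSubgroup S)) := by
      rintro g ⟨a, ha, b, hb, hg⟩
      exact ⟨b⁻¹, (hsym b).1 hb, a⁻¹, (hsym a).1 ha, by simp [hg]⟩
    have hgrowth : ∀ h : evenSubgroup S,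
        ∀ g ∈ ((↑) ⁻¹' {g : G | ∃ a ∈ S, ∃ b ∈ S, g = a * b} : Set (evenSubgroup S)),
        √(energy f (h * g : evenSubgroup S)) ≤ √(energy f h) + √M := by
      rintro h g ⟨a, ha, b, hb, hg⟩
      have hgM : energy f g ≤ M := by
        rw [hg]
        exact hle ha hb
      exact (sqrt_energy_mul_le f h g).trans (by gcongr)
    have hρ := le_card_mul_of_closure_eq_top hinv closure_preimage_evenSubgroup
      (ρ := fun h : evenSubgroup S => √(energy f h)) (Real.sqrt_nonneg M) hgrowth h
    have hone : energy f 1 = 0 := by simp [energy]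
    simp only [OneMemClass.coe_one, hone, Real.sqrt_zero, zero_add,
      ← Nat.card_eq_fintype_card] at hρ
    calc energy f h = √(energy f h) ^ 2 := (Real.sq_sqrt (energy_nonneg _ _)).symm
      _ ≤ (Nat.card (evenSubgroup S) * √M) ^ 2 := by gcongr
      _ = _ := by rw [mul_pow, Real.sq_sqrt hM0]
  have hsum := Finset.sum_le_sum fun h (_ : h ∈ Finset.univ) => hbound h
  rw [sum_energy_subgroup hf] at hsum
  have hN : (0 : ℝ) < Nat.card (evenSubgroup S) := by exact_mod_cast Nat.card_pos
  simp only [Finset.sum_const, Finset.card_univ, ← Nat.card_eq_fintype_card, nsmul_eq_mul] at hsum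
  refine le_of_mul_le_mul_left ?_ hN
  linarith

/-- The contraction factor of two steps of the walk. -/
noncomputable def contraction (S : Finset G) : ℝ :=
  1 - 1 / ((S.card : ℝ) ^ 2 * (Nat.card (evenSubgroup S) : ℝ) ^ 2)

lemma contraction_nonneg (hS : S.Nonempty) : 0 ≤ contraction S := by
  have hd : (1 : ℝ) ≤ S.card := by exact_mod_cast hS.card_pos
  have hN : (1 : ℝ) ≤ Nat.card (evenSubgroup S) := by
    exact_mod_cast (Nat.card_pos : 0 < Nat.card (evenSubgroup S))
  rw [contraction, sub_nonneg, ← mul_pow]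
  exact div_le_one_of_le₀ (one_le_pow₀ (one_le_mul_of_one_le_of_one_le hd hN)) (by positivity)

lemma sum_sq_transition_mulVec_le (hsym : ∀ a : G, a ∈ S ↔ a⁻¹ ∈ S) (hS : S.Nonempty)
    {f : G → ℝ} (hf : IsCentered (evenSubgroup S) f) :
    ∑ x, (transition S).mulVec f x ^ 2 ≤ contraction S * ∑ x, f x ^ 2 := by
  have hd : (0 : ℝ) < S.card := by exact_mod_cast hS.card_pos
  have hN : (0 : ℝ) < Nat.card (evenSubgroup S) := by exact_mod_cast Nat.card_pos
  have hgap : 1 / ((S.card : ℝ) ^ 2 * (Nat.card (evenSubgroup S) : ℝ) ^ 2) * ∑ x, f x ^ 2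
      ≤ (∑ s ∈ S, ∑ t ∈ S, energy f (s⁻¹ * t)) / (2 * S.card ^ 2) := by
    have := two_mul_sum_sq_le hsym hf
    rw [div_mul_eq_mul_div, one_mul, div_le_div_iff₀ (by positivity) (by positivity)]
    nlinarith [mul_le_mul_of_nonneg_left this (sq_nonneg (S.card : ℝ))]
  rw [sum_sq_transition_mulVec hS, contraction, sub_mul, one_mul]
  linarith

lemma sum_sq_transition_sq_mulVec_le (hsym : ∀ a : G, a ∈ S ↔ a⁻¹ ∈ S) (hS : S.Nonempty)
    {f : G → ℝ} (hf : IsCentered (evenSubgroup S) f) :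
    ∑ x, (transition S ^ 2).mulVec f x ^ 2 ≤ contraction S ^ 2 * ∑ x, f x ^ 2 := by
  set g := (transition S ^ 2).mulVec f with hg
  have hgf := sum_sq_transition_mulVec_le hsym hS (hf.transition_sq_mulVec hS)
  have hff := sum_sq_transition_mulVec_le hsym hS hf
  have hself : ∑ x, g x ^ 2
      = ∑ x, (transition S).mulVec f x * (transition S).mulVec g x := by
    have : g ⬝ᵥ g = (transition S).mulVec f ⬝ᵥ (transition S).mulVec g := by
      nth_rewrite 1 [hg]
      rw [pow_two, ← Matrix.mulVec_mulVec, dotProduct_comm, Matrix.dotProduct_mulVec, ← Matrix.mulVec_transpose,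
        transition_isSymm hsym, dotProduct_comm]
    simpa [dotProduct, pow_two] using this
  have hcs := Finset.sum_mul_sq_le_sq_mul_sq Finset.univ
    ((transition S).mulVec f) ((transition S).mulVec g)
  rw [← hself] at hcs
  have hg0 : 0 ≤ ∑ x, g x ^ 2 := Finset.sum_nonneg fun x _ => sq_nonneg _
  have hf0 : 0 ≤ ∑ x, f x ^ 2 := Finset.sum_nonneg fun x _ => sq_nonneg _
  have hprod := mul_le_mul hff hgf (Finset.sum_nonneg fun x _ => sq_nonneg _)
    (mul_nonneg (contraction_nonneg hS) hf0)
  rcases hg0.eq_or_lt with h0 | hpos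
  · rw [← h0]
    positivity
  · refine le_of_mul_le_mul_right ?_ hpos
    linarith

lemma IsCentered.transition_pow_mulVec (hS : S.Nonempty) {f : G → ℝ}
    (hf : IsCentered (evenSubgroup S) f) (n : ℕ) :
    IsCentered (evenSubgroup S) ((transition S ^ (2 * n)).mulVec f) := by
  induction n with
  | zero => simpa using hf
  | succ n ih =>
    rw [mul_add, mul_one, add_comm, pow_add, ← Matrix.mulVec_mulVec]
    exact ih.transition_sq_mulVec hS

lemma sum_sq_transition_pow_mulVec_le (hsym : ∀ a : G, a ∈ S ↔ a⁻¹ ∈ S) (hS : S.Nonempty)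
    {f : G → ℝ} (hf : IsCentered (evenSubgroup S) f) (n : ℕ) :
    ∑ x, (transition S ^ (2 * n)).mulVec f x ^ 2 ≤ (contraction S ^ n) ^ 2 * ∑ x, f x ^ 2 := by
  induction n with
  | zero => simp
  | succ n ih =>
    rw [mul_add, mul_one, add_comm, pow_add, ← Matrix.mulVec_mulVec]
    calc _ ≤ contraction S ^ 2 * ∑ x, (transition S ^ (2 * n)).mulVec f x ^ 2 :=
          sum_sq_transition_sq_mulVec_le hsym hS (hf.transition_pow_mulVec hS n)
      _ ≤ contraction S ^ 2 * ((contraction S ^ n) ^ 2 * ∑ x, f x ^ 2) := by gcongr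
      _ = _ := by ring

/-- The uniform distribution on `K`. -/
noncomputable def uniform (K : Subgroup G) : G → ℝ := fun x => if x ∈ K then 1 / Nat.card K else 0

lemma sum_uniform (K : Subgroup G) : ∑ x, uniform K x = 1 := by
  have hN : (Nat.card K : ℝ) ≠ 0 := by exact_mod_cast Nat.card_pos.ne'
  rw [← sum_subgroup (K := K) fun x hx => by simp [uniform, hx]]
  simp only [uniform, SetLike.coe_mem, if_true, Finset.sum_const, Finset.card_univ,
    ← Nat.card_eq_fintype_card, nsmul_eq_mul]
  field_simp

lemma isCentered_single_sub_uniform (K : Subgroup G) :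
    IsCentered K (Pi.single 1 1 - uniform K) := by
  constructor
  · intro x hx
    have : x ≠ 1 := fun h => hx (h ▸ K.one_mem)
    simp [uniform, hx, this]
  · simp [sum_uniform]

lemma sum_sq_single_sub_uniform_le (K : Subgroup G) :
    ∑ x, (Pi.single 1 1 - uniform K : G → ℝ) x ^ 2 ≤ 1 := by
  have hN : (1 : ℝ) ≤ Nat.card K := by exact_mod_cast (Nat.card_pos : 0 < Nat.card K)
  have hsq (x : G) : (Pi.single 1 1 - uniform K : G → ℝ) x ^ 2
      = Pi.single (M := fun _ => ℝ) 1 1 x * (1 - 2 / Nat.card K)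
        + uniform K x * (1 / Nat.card K) := by
    by_cases h : x = 1
    · subst h
      simp [uniform, K.one_mem]
      ring
    · by_cases hx : x ∈ K <;> simp [uniform, h, hx, pow_two]
  simp only [hsq, Finset.sum_add_distrib, ← Finset.sum_mul, sum_uniform]
  simp only [Finset.sum_pi_single', Finset.mem_univ, if_true, one_mul]
  have : 0 ≤ 1 / (Nat.card K : ℝ) := by positivity
  have h2 : 2 / (Nat.card K : ℝ) = 2 * (1 / Nat.card K) := by ring
  linarith

lemma transition_sq_mulVec_uniform (hS : S.Nonempty) :
    (transition S ^ 2).mulVec (uniform (evenSubgroup S)) = uniform (evenSubgroup S) := by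
  have hd : (S.card : ℝ) ≠ 0 := by exact_mod_cast hS.card_pos.ne'
  ext x
  have hinv : ∀ s ∈ S, ∀ t ∈ S, uniform (evenSubgroup S) (x * (s * t))
      = uniform (evenSubgroup S) x := fun s hs t ht => by
    simp only [uniform, Subgroup.mul_mem_cancel_right _ (mul_mem_evenSubgroup hs ht)]
  rw [transition_sq_mulVec, Finset.sum_congr rfl fun s hs => Finset.sum_congr rfl (hinv s hs)]
  simp only [Finset.sum_const, nsmul_eq_mul]
  field_simp

lemma transition_pow_mulVec_uniform (hS : S.Nonempty) (n : ℕ) :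
    (transition S ^ (2 * n)).mulVec (uniform (evenSubgroup S)) = uniform (evenSubgroup S) := by
  induction n with
  | zero => simp
  | succ n ih =>
    rw [mul_add, mul_one, pow_add, ← Matrix.mulVec_mulVec, transition_sq_mulVec_uniform hS, ih]

lemma transition_pow_mulVec_single_sub_uniform (hsym : ∀ a : G, a ∈ S ↔ a⁻¹ ∈ S)
    (hS : S.Nonempty) (n : ℕ) (h : evenSubgroup S) :
    (transition S ^ (2 * n)).mulVec (Pi.single 1 1 - uniform (evenSubgroup S)) h
      = (transition S ^ (2 * n)) 1 h - 1 / Nat.card (evenSubgroup S) := by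
  rw [Matrix.mulVec_sub, transition_pow_mulVec_uniform hS, Matrix.mulVec_single_one,
    ← ((transition_isSymm hsym).pow (2 * n)).apply]
  simp [uniform]

theorem sum_abs_transition_pow_sub_le (hsym : ∀ a : G, a ∈ S ↔ a⁻¹ ∈ S) (hS : S.Nonempty)
    (n : ℕ) :
    ∑ h : evenSubgroup S,
        |(transition S ^ (2 * n)) 1 (h : G) - 1 / (Nat.card (evenSubgroup S) : ℝ)|
      ≤ √(Nat.card (evenSubgroup S)) * contraction S ^ n := by
  set F := (transition S ^ (2 * n)).mulVec (Pi.single 1 1 - uniform (evenSubgroup S)) with hF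
  have hcentered : IsCentered (evenSubgroup S) F :=
    (isCentered_single_sub_uniform _).transition_pow_mulVec hS n
  have hsq : ∑ h : evenSubgroup S, |F h| ^ 2 ≤ (contraction S ^ n) ^ 2 := by
    simp only [sq_abs]
    rw [sum_subgroup (f := fun x => F x ^ 2) fun x hx => by simp [hcentered.1 x hx]]
    refine (sum_sq_transition_pow_mulVec_le hsym hS (isCentered_single_sub_uniform _) n).trans ?_
    exact mul_le_of_le_one_right (sq_nonneg _) (sum_sq_single_sub_uniform_le _)
  have hcs := sq_sum_le_card_mul_sum_sq (s := Finset.univ) (f := fun h : evenSubgroup S => |F h|)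
  rw [Finset.card_univ, ← Nat.card_eq_fintype_card] at hcs
  simp only [← transition_pow_mulVec_single_sub_uniform hsym hS, ← hF]
  refine abs_le_of_sq_le_sq' ?_
    (mul_nonneg (Real.sqrt_nonneg _) (pow_nonneg (contraction_nonneg hS) n)) |>.2
  rw [mul_pow, Real.sq_sqrt (Nat.cast_nonneg _)]
  exact hcs.trans (mul_le_mul_of_nonneg_left hsq (Nat.cast_nonneg _))

end RandomWalk

/-- Convergence of the simple random walk on a finite group `G` with symmetric generating set
`S` (with `1 ∉ S`): after `2n` steps, started at the identity, the distribution is within total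
variation distance `½ √|H̃| (1 − 1/(|S|²|H̃|²))ⁿ` of the uniform distribution on the subgroup
`H̃ = ⟨{ab : a, b ∈ S}⟩`, i.e. the sum of the absolute deviations is at most
`√|H̃| (1 − 1/(|S|²|H̃|²))ⁿ`. -/
theorem random_walk_convergence (G : Type*) [Group G] [Fintype G] (S : Finset G)
    (hsym : ∀ a : G, a ∈ S ↔ a⁻¹ ∈ S) (h1 : (1 : G) ∉ S)
    (hgen : Subgroup.closure (S : Set G) = ⊤) :
    ∀ n : ℕ, 1 ≤ n →
      let P : Matrix G G ℝ := fun x y => if x⁻¹ * y ∈ S then (1 : ℝ) / S.card else 0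
      let Ht : Subgroup G := Subgroup.closure {g : G | ∃ a ∈ S, ∃ b ∈ S, g = a * b}
      ∑ h : Ht, |(P ^ (2 * n)) 1 (h : G) - 1 / (Nat.card Ht : ℝ)|
        ≤ Real.sqrt (Nat.card Ht) *
            (1 - 1 / ((S.card : ℝ) ^ 2 * (Nat.card Ht : ℝ) ^ 2)) ^ n := by
  intro n hn P Ht
  rcases S.eq_empty_or_nonempty with rfl | hS
  · have hP : P = 0 := by
      ext x y
      simp [P]
    have hHt : Ht = ⊥ := by simp [Ht]
    have hcard : Nat.card Ht = 1 := by simp [hHt]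
    have hpow : P ^ (2 * n) = 0 := by
      rw [hP, zero_pow (by omega)]
    simp [hpow, hcard, ← Nat.card_eq_fintype_card]
  · exact RandomWalk.sum_abs_transition_pow_sub_le hsym hS n
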